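/- arXiv:2503.13274 — 2 statements merged into one kernel-verified Lean document; each statement's English description precedes it below -/
import Mathlib

section
/- Let G=(V,E) be an undirected graph with n ≥ 2 vertices and m edges, let η ≥ 0 and 0 < γ ≤ 1, let c: E→ℝ_{≥0} be edge capacities with c(e) ≤ η for every e ∈ E, let Δ: V→ℝ_{≥0} be a source function with ∑_{v∈V} Δ(v) ≤ 2m and Δ(v) ≤ η·deg_G(v) for every v, let ∇: V→ℝ_{≥0} be sink capacities with ∇(v) ≥ γ·deg_G(v) for every v, and let h ∈ ℕ be a height parameter. Then there exist a preflow f for (G, c, Δ) with nonnegative mass m_f(v) ≥ 0 at every vertex, and a labeling l: V→{0, 1, …, h}, such that: (i) for every edge {u,v} ∈ E with l(u) > l(v)+1, the edge is saturated in the direction from u to v, i.e., f(u,v) = c({u,v}); (ii) every vertex u with l(u) ≥ 1 has nearly saturated sink, i.e., abs_f(u) ≥ ∇(u)/(8·log n); and (iii) every vertex u with l(u) < h has no excess, i.e., ex_f(u) = 0. -/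
open Finset

/-- The mass at `v` when the source mass `Δ` is routed along `f`. -/
def flowMass {V : Type*} [Fintype V] (Δ : V → ℝ) (f : V → V → ℝ) (v : V) : ℝ :=
  Δ v + ∑ u, f u v

/-- The preflows for `(G, c, Δ)` with nonnegative mass at every vertex. -/
def preflowSet {V : Type*} [Fintype V] (G : SimpleGraph V) (c : Sym2 V → ℝ) (Δ : V → ℝ) :
    Set (V → V → ℝ) :=
  {f | (∀ u v, f u v = - f v u) ∧ (∀ u v, ¬ G.Adj u v → f u v = 0) ∧
    (∀ u v, G.Adj u v → |f u v| ≤ c s(u, v)) ∧ ∀ v, 0 ≤ flowMass Δ f v}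

/-- The antisymmetric function sending one unit from `u` to `v`. -/
def unitPush {V : Type*} [DecidableEq V] (u v : V) (a b : V) : ℝ :=
  (if a = u then 1 else 0) * (if b = v then 1 else 0) -
    (if a = v then 1 else 0) * (if b = u then 1 else 0)

/-- The squared distance of the masses of `f` from the sink capacities. -/
def sinkPotential {V : Type*} [Fintype V] (Δ Nab : V → ℝ) (f : V → V → ℝ) : ℝ :=
  ∑ v, (flowMass Δ f v - Nab v) ^ 2

lemma continuous_flowMass {V : Type*} [Fintype V] (Δ : V → ℝ) (v : V) :
    Continuous fun f : V → V → ℝ => flowMass Δ f v := by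
  unfold flowMass
  fun_prop

lemma isCompact_preflowSet {V : Type*} [Fintype V] (G : SimpleGraph V) {c : Sym2 V → ℝ}
    (hc : ∀ e, 0 ≤ c e) (Δ : V → ℝ) : IsCompact (preflowSet G c Δ) := by
  refine (isCompact_Icc (a := fun u v => - c s(u, v))
    (b := fun u v => c s(u, v))).of_isClosed_subset ?_ ?_
  · simp only [preflowSet, Set.ofPred_and, Set.ofPred_forall]
    refine IsClosed.inter ?_ (IsClosed.inter ?_ (IsClosed.inter ?_ ?_))
    · exact isClosed_iInter fun u => isClosed_iInter fun v =>
        isClosed_eq (by fun_prop) (by fun_prop)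
    · exact isClosed_iInter fun u => isClosed_iInter fun v => isClosed_iInter fun _ =>
        isClosed_eq (by fun_prop) (by fun_prop)
    · exact isClosed_iInter fun u => isClosed_iInter fun v => isClosed_iInter fun _ =>
        isClosed_le (by fun_prop) (by fun_prop)
    · exact isClosed_iInter fun v => isClosed_le (by fun_prop) (continuous_flowMass Δ v)
  · rintro f ⟨-, h0, hb, -⟩
    have key : ∀ u v, |f u v| ≤ c s(u, v) := fun u v => by
      by_cases huv : G.Adj u v
      · exact hb u v huv
      · simpa [h0 u v huv] using hc s(u, v)
    exact ⟨fun u v => (abs_le.1 (key u v)).1, fun u v => (abs_le.1 (key u v)).2⟩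

lemma zero_mem_preflowSet {V : Type*} [Fintype V] (G : SimpleGraph V) {c : Sym2 V → ℝ}
    (hc : ∀ e, 0 ≤ c e) {Δ : V → ℝ} (hΔ : ∀ v, 0 ≤ Δ v) :
    (fun _ _ => 0) ∈ preflowSet G c Δ := by
  simp [preflowSet, flowMass, hc, hΔ]

lemma exists_isMinOn_sinkPotential {V : Type*} [Fintype V] (G : SimpleGraph V)
    {c : Sym2 V → ℝ} (hc : ∀ e, 0 ≤ c e) {Δ : V → ℝ} (hΔ : ∀ v, 0 ≤ Δ v) (Nab : V → ℝ) :
    ∃ f ∈ preflowSet G c Δ, IsMinOn (sinkPotential Δ Nab) (preflowSet G c Δ) f := by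
  refine (isCompact_preflowSet G hc Δ).exists_isMinOn ⟨_, zero_mem_preflowSet G hc hΔ⟩ ?_
  have := continuous_flowMass Δ
  unfold sinkPotential
  fun_prop

lemma flowMass_push {V : Type*} [Fintype V] [DecidableEq V] (Δ : V → ℝ) (f : V → V → ℝ)
    (u v : V) (ε : ℝ) (b : V) :
    flowMass Δ (fun x y => f x y + ε * unitPush u v x y) b =
      flowMass Δ f b + ε * ((if b = v then 1 else 0) - (if b = u then 1 else 0)) := by
  simp only [flowMass, unitPush, sum_add_distrib, ← mul_sum, sum_sub_distrib, ← sum_mul,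
    sum_ite_eq', mem_univ, if_true, one_mul]
  ring

lemma sinkPotential_push {V : Type*} [Fintype V] [DecidableEq V] (Δ Nab : V → ℝ)
    (f : V → V → ℝ) {u v : V} (huv : u ≠ v) (ε : ℝ) :
    sinkPotential Δ Nab (fun x y => f x y + ε * unitPush u v x y) =
      sinkPotential Δ Nab f +
        2 * ε * ((flowMass Δ f v - Nab v) - (flowMass Δ f u - Nab u) + ε) := by
  have expand : ∀ b, (flowMass Δ (fun x y => f x y + ε * unitPush u v x y) b - Nab b) ^ 2 =
      (flowMass Δ f b - Nab b) ^ 2 +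
        ((if b = v then 2 * ε * (flowMass Δ f b - Nab b) + ε ^ 2 else 0) +
          (if b = u then - 2 * ε * (flowMass Δ f b - Nab b) + ε ^ 2 else 0)) := by
    intro b
    rw [flowMass_push]
    by_cases hv : b = v
    · have hu : b ≠ u := fun h => huv (h.symm.trans hv)
      simp only [hv, huv.symm, if_true, if_false]
      ring
    · by_cases hu : b = u <;> simp only [hv, hu, huv, if_true, if_false] <;> ring
  simp only [sinkPotential, expand, sum_add_distrib, sum_ite_eq', mem_univ, if_true]
  ring

lemma push_mem_preflowSet {V : Type*} [Fintype V] [DecidableEq V] {G : SimpleGraph V}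
    {c : Sym2 V → ℝ} {Δ : V → ℝ} {f : V → V → ℝ} (hf : f ∈ preflowSet G c Δ) {u v : V}
    (huv : G.Adj u v) {ε : ℝ} (hε : 0 ≤ ε) (hcap : f u v + ε ≤ c s(u, v))
    (hmass : ε ≤ flowMass Δ f u) :
    (fun x y => f x y + ε * unitPush u v x y) ∈ preflowSet G c Δ := by
  obtain ⟨hanti, hzero, hbound, hnonneg⟩ := hf
  have hne : u ≠ v := huv.ne
  refine ⟨fun a b => ?_, fun a b hab => ?_, fun a b hab => ?_, fun b => ?_⟩
  · simp only [unitPush, hanti a b]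
    ring
  · have h1 : ¬ (a = u ∧ b = v) := by
      rintro ⟨rfl, rfl⟩
      exact hab huv
    have h2 : ¬ (a = v ∧ b = u) := by
      rintro ⟨rfl, rfl⟩
      exact hab huv.symm
    simp only [hzero a b hab, unitPush, ← ite_and, ite_mul, one_mul, zero_mul, h1, h2, if_false]
    ring
  · have hb := abs_le.1 (hbound a b hab)
    simp only [unitPush]
    by_cases h1 : a = u ∧ b = v
    · obtain ⟨rfl, rfl⟩ := h1
      simp only [hne, hne.symm, if_true, if_false]
      rw [abs_le]
      constructor <;> linarith
    · by_cases h2 : a = v ∧ b = u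
      · obtain ⟨rfl, rfl⟩ := h2
        have := hanti a b
        rw [Sym2.eq_swap] at hb ⊢
        simp only [hne, hne.symm, if_true, if_false]
        rw [abs_le]
        constructor <;> linarith
      · simp only [← ite_and, ite_mul, one_mul, zero_mul, h1, h2, if_false, sub_zero, mul_zero,
          add_zero]
        exact hbound a b hab
  · rw [flowMass_push]
    have := hnonneg b
    by_cases hu : b = u
    · subst hu
      simp only [hne, if_true, if_false]
      linarith
    · rw [if_neg hu]
      split_ifs <;> linarith

/-- A potential-minimizing preflow saturates every edge from a vertex with positive mass and
saturated sink to a vertex with unsaturated sink. -/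
lemma eq_capacity_of_isMinOn_sinkPotential {V : Type*} [Fintype V] [DecidableEq V] {G : SimpleGraph V}
    {c : Sym2 V → ℝ} {Δ Nab : V → ℝ} {f : V → V → ℝ} (hf : f ∈ preflowSet G c Δ)
    (hmin : IsMinOn (sinkPotential Δ Nab) (preflowSet G c Δ) f) {u v : V} (huv : G.Adj u v)
    (hpos : 0 < flowMass Δ f u) (hu : Nab u ≤ flowMass Δ f u) (hv : flowMass Δ f v < Nab v) :
    f u v = c s(u, v) := by
  by_contra hne
  have hlt : f u v < c s(u, v) := lt_of_le_of_ne (abs_le.1 (hf.2.2.1 u v huv)).2 hne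
  obtain ⟨ε, hε, hε'⟩ := exists_between (show (0 : ℝ) < min (c s(u, v) - f u v)
    (min (flowMass Δ f u) (Nab v - flowMass Δ f v)) from
      lt_min (sub_pos.2 hlt) (lt_min hpos (sub_pos.2 hv)))
  rw [lt_min_iff, lt_min_iff] at hε'
  obtain ⟨hcap, hmass, hgap⟩ := hε'
  have hle := isMinOn_iff.1 hmin _
    (push_mem_preflowSet hf huv hε.le (by linarith) hmass.le)
  rw [sinkPotential_push Δ Nab f huv.ne] at hle
  have : 2 * ε * ((flowMass Δ f v - Nab v) - (flowMass Δ f u - Nab u) + ε) < 0 :=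
    mul_neg_of_pos_of_neg (by linarith) (by linarith)
  linarith

/-- parallel unit flow, existence of preflow and labeling.
Let `G` be a graph on `n ≥ 2` vertices with `m` edges, `η ≥ 0`, `0 < γ ≤ 1`,
edge capacities `c(e) ≤ η`, sources `Δ ≥ 0` with `∑ Δ ≤ 2m` and
`Δ(v) ≤ η·deg(v)`, sinks `∇(v) ≥ γ·deg(v)`, and a height `h`. Then there
exist a preflow `f` for `(G, c, Δ)` with nonnegative mass at every vertex
and a labeling `l : V → {0,…,h}` such that:
(i) every edge `{u,v}` with `l(u) > l(v)+1` is saturated from `u` to `v`;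
(ii) every `u` with `l(u) ≥ 1` has `abs_f(u) ≥ ∇(u)/(8·log n)`;
(iii) every `u` with `l(u) < h` has `ex_f(u) = 0`.
Here the mass is `m_f(v) = Δ(v) + ∑_u f(u,v)`, the absorbed amount is
`abs_f(v) = min(m_f(v), ∇(v))` and the excess is
`ex_f(v) = max(0, m_f(v) − ∇(v))`. -/
theorem parallel_unit_flow_exists
    {V : Type*} [Fintype V] [DecidableEq V]
    (G : SimpleGraph V) [DecidableRel G.Adj]
    (η γ : ℝ) (c : Sym2 V → ℝ) (Δ Nab : V → ℝ) (h : ℕ)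
    (hn : 2 ≤ Fintype.card V)
    (hη : 0 ≤ η) (hγ0 : 0 < γ) (hγ1 : γ ≤ 1)
    (hc0 : ∀ e, 0 ≤ c e)
    (hcη : ∀ e ∈ G.edgeFinset, c e ≤ η)
    (hΔ0 : ∀ v, 0 ≤ Δ v)
    (hΔsum : (∑ v, Δ v) ≤ 2 * (G.edgeFinset.card : ℝ))
    (hΔdeg : ∀ v, Δ v ≤ η * (G.degree v : ℝ))
    (hNab0 : ∀ v, 0 ≤ Nab v)
    (hNab : ∀ v, γ * (G.degree v : ℝ) ≤ Nab v) :
    ∃ (f : V → V → ℝ) (l : V → ℕ),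
      (∀ u v, f u v = - f v u) ∧
      (∀ u v, ¬ G.Adj u v → f u v = 0) ∧
      (∀ u v, G.Adj u v → |f u v| ≤ c s(u, v)) ∧
      (∀ v, 0 ≤ Δ v + ∑ u, f u v) ∧
      (∀ v, l v ≤ h) ∧
      (∀ u v, G.Adj u v → l v + 1 < l u → f u v = c s(u, v)) ∧
      (∀ u, 1 ≤ l u →
        Nab u / (8 * Real.logb 2 (Fintype.card V)) ≤
          min (Δ u + ∑ w, f w u) (Nab u)) ∧
      (∀ u, l u < h → max 0 ((Δ u + ∑ w, f w u) - Nab u) = 0) := by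
  classical
  obtain ⟨f, hf, hmin⟩ := exists_isMinOn_sinkPotential G hc0 hΔ0 Nab
  refine ⟨f, fun v => if flowMass Δ f v < Nab v then 0 else h, hf.1, hf.2.1, hf.2.2.1, hf.2.2.2,
    fun v => ?_, fun u v huv hl => ?_, fun u hl => ?_, fun u hl => ?_⟩
  · dsimp only
    split_ifs <;> omega
  · dsimp only at hl
    split_ifs at hl with hv hu hu <;> try omega
    have hdeg : (0 : ℝ) < G.degree u :=
      Nat.cast_pos.2 ((G.degree_pos_iff_exists_adj u).2 ⟨v, huv⟩)
    have hpos : 0 < Nab u := (mul_pos hγ0 hdeg).trans_le (hNab u)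
    exact eq_capacity_of_isMinOn_sinkPotential hf hmin huv (hpos.trans_le (not_lt.1 hu)) (not_lt.1 hu) hv
  · dsimp only at hl
    split_ifs at hl with hu <;> try omega
    have hlog : 1 ≤ Real.logb 2 (Fintype.card V) := by
      rw [Real.le_logb_iff_rpow_le one_lt_two (by positivity), Real.rpow_one]
      exact_mod_cast hn
    change _ ≤ min (flowMass Δ f u) (Nab u)
    rw [min_eq_right (not_lt.1 hu)]
    exact div_le_self (hNab0 u) (by linarith)
  · dsimp only at hl
    split_ifs at hl with hu <;> try omega
    exact max_eq_left (sub_nonpos.2 hu.le)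
end

section
/- Let G=(V,E) be an undirected graph, let 0 < γ ≤ 1, let Δ: V→ℝ_{≥0} be a source function, let ∇: V→ℝ_{≥0} be sink capacities with ∇(v) ≥ γ·deg_G(v) for every v ∈ V, and let f be a preflow for (G, c, Δ) (for any edge capacities c) whose mass is nonnegative at every vertex, i.e., m_f(v) ≥ 0 for all v ∈ V. Then the set S = {v ∈ V : m_f(v) ≥ ∇(v)} of vertices with no remaining sink capacity satisfies deg_G(S) ≤ (∑_{v∈V} Δ(v))/γ. -/
open Finset

/-- Sum of degrees (in `G`) of the vertices in `S`. -/
def degSum {V : Type*} [Fintype V] (G : SimpleGraph V) [DecidableRel G.Adj]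
    (S : Finset V) : ℕ :=
  ∑ v ∈ S, G.degree v

/-- The entries of an antisymmetric real function sum to zero. -/
theorem sum_sum_eq_zero_of_antisymm {V : Type*} [Fintype V] (f : V → V → ℝ)
    (hanti : ∀ u v, f u v = - f v u) : ∑ v, ∑ u, f u v = 0 := by
  have h : ∑ v, ∑ u, f u v = -∑ v, ∑ u, f u v := by
    conv_lhs => rw [Finset.sum_comm]
    simp_rw [← Finset.sum_neg_distrib]
    exact Finset.sum_congr rfl fun u _ => Finset.sum_congr rfl fun v _ => hanti u v
  linarith

/-- saturated vertices have small total degree.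
Let `G` be a graph, `0 < γ ≤ 1`, `Δ ≥ 0` a source function, `∇` sink
capacities with `∇(v) ≥ γ·deg(v)`, and `f` a preflow for `(G, c, Δ)`
(for any edge capacities `c`) whose mass `m_f(v) = Δ(v) + ∑_u f(u,v)` is
nonnegative at every vertex. Then the set
`S = {v : m_f(v) ≥ ∇(v)}` of vertices with no remaining sink capacity
satisfies `deg_G(S) ≤ (∑_v Δ(v))/γ`. -/
theorem saturated_vertices_degree_bound
    {V : Type*} [Fintype V] [DecidableEq V]
    (G : SimpleGraph V) [DecidableRel G.Adj]
    (γ : ℝ) (c : Sym2 V → ℝ) (Δ Nab : V → ℝ) (f : V → V → ℝ)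
    (hγ0 : 0 < γ) (hγ1 : γ ≤ 1)
    (hΔ0 : ∀ v, 0 ≤ Δ v)
    (hc0 : ∀ e, 0 ≤ c e)
    (hNab : ∀ v, γ * (G.degree v : ℝ) ≤ Nab v)
    (hanti : ∀ u v, f u v = - f v u)
    (hsupp : ∀ u v, ¬ G.Adj u v → f u v = 0)
    (hcap : ∀ u v, G.Adj u v → |f u v| ≤ c s(u, v))
    (hmass : ∀ v, 0 ≤ Δ v + ∑ u, f u v) :
    (degSum G (Finset.univ.filter fun v => Nab v ≤ Δ v + ∑ u, f u v) : ℝ)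
      ≤ (∑ v, Δ v) / γ := by
  have hflow : ∑ v, ∑ u, f u v = 0 := sum_sum_eq_zero_of_antisymm f hanti
  rw [le_div_iff₀ hγ0, degSum, Nat.cast_sum, mul_comm, Finset.mul_sum]
  calc ∑ v ∈ Finset.univ.filter (fun v => Nab v ≤ Δ v + ∑ u, f u v), γ * (G.degree v : ℝ)
      ≤ ∑ v ∈ Finset.univ.filter (fun v => Nab v ≤ Δ v + ∑ u, f u v),
          (Δ v + ∑ u, f u v) :=
        Finset.sum_le_sum fun v hv => (hNab v).trans (Finset.mem_filter.mp hv).2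
    _ ≤ ∑ v, (Δ v + ∑ u, f u v) :=
        Finset.sum_le_sum_of_subset_of_nonneg (Finset.filter_subset _ _)
          fun v _ _ => hmass v
    _ = ∑ v, Δ v := by rw [Finset.sum_add_distrib, hflow, add_zero]
end
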